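/- There exist absolute constants c > 0 and C > 0 such that the following holds. Let A ⊆ {0,…,N−1} have |A| = α·N with α > 0, and suppose A is 3AP-free. If N ≥ C·α^{−32}, then there exists an arithmetic progression P of integers with P ⊆ {0,…,N−1}, |P| ≥ c·α^{16}·N^{1/2}, and |A ∩ P| ≥ (α + c·α^{11})·|P|. -/

import Mathlib

/-- `P` is an arithmetic progression of integers: `P = {a, a+s, …, a+(k−1)s}`
with `s ≠ 0` and `k ≥ 1`. -/
def IsAP (P : Finset ℤ) : Prop :=
  ∃ a s : ℤ, s ≠ 0 ∧ ∃ k : ℕ, 1 ≤ k ∧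
    P = (Finset.range k).image (fun i : ℕ => a + (i : ℤ) * s)

open Finset
open scoped FourierTransform

lemma sum_fourierChar_div (M : ℕ) (hM : 0 < M) (n : ℤ) :
    ∑ r ∈ range M, (𝐞 ((r : ℝ) * ((n : ℝ) / M)) : ℂ) = if (M : ℤ) ∣ n then (M : ℂ) else 0 := by
  have hM' : (M : ℝ) ≠ 0 := by positivity
  have hMC : (M : ℂ) ≠ 0 := by exact_mod_cast hM.ne'
  have hpow (r : ℕ) : (𝐞 ((r : ℝ) * ((n : ℝ) / M)) : ℂ) = (𝐞 ((n : ℝ) / M) : ℂ) ^ r := by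
    rw [← nsmul_eq_mul, AddChar.map_nsmul_eq_pow, Circle.coe_pow]
  simp_rw [hpow]
  have hone : (𝐞 ((n : ℝ) / M) : ℂ) = 1 ↔ (M : ℤ) ∣ n := by
    rw [Real.fourierChar_apply, Complex.exp_eq_one_iff]
    constructor
    · rintro ⟨k, hk⟩
      refine ⟨k, ?_⟩
      have h2 : (n : ℂ) / M = k := by
        apply mul_right_cancel₀ Complex.two_pi_I_ne_zero
        rw [← hk]; push_cast; ring
      rw [div_eq_iff hMC] at h2
      rw [mul_comm]
      exact_mod_cast h2
    · rintro ⟨k, rfl⟩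
      refine ⟨k, ?_⟩
      push_cast
      field_simp
  split_ifs with h
  · simp [hone.2 h]
  · have hne := mt hone.1 h
    have hw : (𝐞 ((n : ℝ) / M) : ℂ) ^ M = 1 := by
      rw [← hpow, mul_div_cancel₀ _ hM', Real.fourierChar_apply, Complex.exp_eq_one_iff]
      exact ⟨n, by push_cast; ring⟩
    rw [geom_sum_eq hne, hw, sub_self, zero_div]

lemma fourierChar_add_coe (s t : ℝ) : (𝐞 (s + t) : ℂ) = 𝐞 s * 𝐞 t := by
  rw [AddChar.map_add_eq_mul, Circle.coe_mul]

/-- Parseval's identity for the indicator function of a set of residues. -/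
lemma sum_norm_sq_fourierChar {N M : ℕ} (hM : 0 < M) (hNM : N ≤ M) {A : Finset ℤ}
    (hA : A ⊆ Ico (0 : ℤ) N) :
    ∑ r ∈ range M, ‖∑ x ∈ A, (𝐞 ((r : ℝ) * ((x : ℝ) / M)) : ℂ)‖ ^ 2 = (M : ℝ) * #A := by
  have key : ∑ r ∈ range M, ((‖∑ x ∈ A, (𝐞 ((r : ℝ) * ((x : ℝ) / M)) : ℂ)‖ ^ 2 : ℝ) : ℂ)
      = ∑ x ∈ A, ∑ z ∈ A, if (M : ℤ) ∣ x - z then (M : ℂ) else 0 := by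
    simp_rw [← sum_fourierChar_div M hM]
    simp_rw [sum_comm (t := range M)]
    refine sum_congr rfl fun r _ ↦ ?_
    push_cast
    rw [← Complex.mul_conj', map_sum, sum_mul_sum]
    refine sum_congr rfl fun x _ ↦ sum_congr rfl fun z _ ↦ ?_
    rw [← Circle.coe_inv_eq_conj, ← AddChar.map_neg_eq_inv, ← fourierChar_add_coe]
    congr 2
    ring
  have hdiag : ∑ x ∈ A, ∑ z ∈ A, (if (M : ℤ) ∣ x - z then (M : ℂ) else 0) = (M : ℂ) * #A := by
    have (x) (hx : x ∈ A) :
        ∑ z ∈ A, (if (M : ℤ) ∣ x - z then (M : ℂ) else 0) = (M : ℂ) := by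
      rw [sum_eq_single_of_mem x hx, if_pos (by simp)]
      intro z hz hzx
      refine if_neg fun hd ↦ hzx ?_
      have h1 := mem_Ico.1 (hA hx)
      have h2 := mem_Ico.1 (hA hz)
      have := Int.eq_zero_of_abs_lt_dvd hd (by rw [abs_lt]; omega)
      omega
    rw [sum_congr rfl this, sum_const, nsmul_eq_mul, mul_comm]
  rw [hdiag] at key
  exact_mod_cast key

lemma sum_fourierChar_threeAP (M : ℕ) (hM : 0 < M) (A I : Finset ℤ) (f : ℤ → ℝ) :
    ∑ r ∈ range M, (∑ x ∈ A, (𝐞 ((r : ℝ) * ((x : ℝ) / M)) : ℂ)) ^ 2 *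
        ∑ y ∈ I, (f y : ℂ) * 𝐞 ((y : ℝ) * (-2 * r / M)) =
      (M : ℂ) * ((∑ x ∈ A, ∑ z ∈ A, ∑ y ∈ I,
        if (M : ℤ) ∣ x + z - 2 * y then f y else 0 : ℝ) : ℂ) := by
  have h (x z y : ℤ) : (M : ℂ) * (((if (M : ℤ) ∣ x + z - 2 * y then f y else 0) : ℝ) : ℂ)
      = ∑ r ∈ range M, (f y : ℂ) * (𝐞 ((r : ℝ) * (((x + z - 2 * y : ℤ) : ℝ) / M)) : ℂ) := by
    rw [← mul_sum, sum_fourierChar_div M hM]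
    split_ifs <;> simp [mul_comm]
  conv_rhs => simp only [Complex.ofReal_sum, mul_sum, h]
  simp_rw [sum_comm (t := range M)]
  refine sum_congr rfl fun r _ ↦ ?_
  rw [sq, sum_mul_sum]
  simp_rw [sum_mul]
  refine sum_congr rfl fun x _ ↦ sum_congr rfl fun z _ ↦ ?_
  rw [mul_sum]
  refine sum_congr rfl fun y _ ↦ ?_
  rw [← fourierChar_add_coe, mul_left_comm, ← fourierChar_add_coe]
  congr 3
  push_cast
  ring

lemma sum_Ico_add_of_support {E : Type*} [AddCommMonoid E] {N K t : ℤ} (h : ℤ → E)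
    (hsupp : ∀ x, x ∉ Ico (0 : ℤ) N → h x = 0) (h0 : 0 ≤ t) (hK : t ≤ K) :
    ∑ a ∈ Ico (-K) N, h (a + t) = ∑ x ∈ Ico (0 : ℤ) N, h x := by
  have : ∑ a ∈ Ico (-K) N, h (a + t) = ∑ x ∈ Ico (-K + t) (N + t), h x := by
    rw [← Finset.image_add_right_Ico, sum_image (by simp)]
  rw [this]
  refine (sum_subset (fun x hx ↦ ?_) fun x _ hx ↦ hsupp x hx).symm
  rw [mem_Ico] at *
  omega

/-- The balanced function of `A` relative to `{0, …, N - 1}`. -/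
noncomputable def balanced (N : ℕ) (A : Finset ℤ) (α : ℝ) (x : ℤ) : ℝ :=
  (if x ∈ A then 1 else 0) - α * (if x ∈ Ico (0 : ℤ) N then 1 else 0)

lemma sum_even_add_ge (A : Finset ℤ) :
    (#A : ℝ) ^ 2 / 2 ≤ ∑ x ∈ A, ∑ z ∈ A, if Even (x + z) then (1 : ℝ) else 0 := by
  have h (x z : ℤ) : (if Even (x + z) then (1 : ℝ) else 0) =
      1 / 2 + (if Even x then (1 : ℝ) else -1) * (if Even z then (1 : ℝ) else -1) / 2 := by
    by_cases hx : Even x <;> by_cases hz : Even z <;> simp [Int.even_add, hx, hz] <;> norm_num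
  simp_rw [h, sum_add_distrib, ← sum_div, ← sum_mul_sum]
  simp only [sum_const, nsmul_eq_mul]
  nlinarith [mul_self_nonneg (∑ x ∈ A, if Even x then (1 : ℝ) else -1)]

/-- A dense 3AP-free set has a large Fourier coefficient. -/
lemma exists_large_fourier {N : ℕ} {A : Finset ℤ} (hA : A ⊆ Ico (0 : ℤ) N) {α : ℝ} (hα : 0 < α)
    (hcard : (#A : ℝ) = α * N)
    (hfree : ¬ ∃ x r : ℤ, r ≠ 0 ∧ x ∈ A ∧ x + r ∈ A ∧ x + 2 * r ∈ A)
    (hN : 4 ≤ α ^ 2 * N) :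
    ∃ θ : ℝ, α ^ 2 / 4 * N ≤
      ‖∑ x ∈ Ico (0 : ℤ) N, (balanced N A α x : ℂ) * 𝐞 ((x : ℝ) * θ)‖ := by
  by_contra! hsmall
  have hN0 : (0 : ℝ) < N := by
    by_contra! h
    nlinarith [sq_nonneg α]
  have hA0 : (0 : ℝ) < #A := by rw [hcard]; positivity
  set M : ℕ := 2 * N + 1 with hMdef
  have hM : 0 < M := by omega
  have hM0 : (0 : ℝ) < M := by exact_mod_cast hM
  set T : ℝ := ∑ x ∈ A, ∑ z ∈ A, ∑ y ∈ Ico (0 : ℤ) N,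
    if (M : ℤ) ∣ x + z - 2 * y then balanced N A α y else 0 with hT
  have hTval : T = ∑ x ∈ A, ∑ z ∈ A,
      ((if x = z then (1 : ℝ) else 0) - α * if Even (x + z) then (1 : ℝ) else 0) := by
    refine sum_congr rfl fun x hx ↦ sum_congr rfl fun z hz ↦ ?_
    have hx' := mem_Ico.1 (hA hx)
    have hz' := mem_Ico.1 (hA hz)
    have hdvd (y : ℤ) (hy : y ∈ Ico (0 : ℤ) N) :
        (M : ℤ) ∣ x + z - 2 * y ↔ x + z = 2 * y := by
      rw [mem_Ico] at hy
      refine ⟨fun hd ↦ ?_, fun h ↦ by simp [h]⟩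
      have := Int.eq_zero_of_abs_lt_dvd hd (by rw [abs_lt]; omega)
      omega
    rw [sum_congr rfl fun y hy ↦ by rw [if_congr (hdvd y hy) rfl rfl]]
    by_cases he : Even (x + z)
    · obtain ⟨m, hm⟩ := he
      have hmI : m ∈ Ico (0 : ℤ) N := by rw [mem_Ico]; omega
      rw [sum_eq_single_of_mem m hmI fun y _ hy ↦ if_neg (by omega), if_pos (by omega),
        balanced, if_pos hmI, if_pos (show Even (x + z) from ⟨m, hm⟩)]
      congr 1
      refine if_congr ⟨fun hmA ↦ ?_, ?_⟩ rfl rfl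
      · by_contra hxz
        refine hfree ⟨x, m - x, by omega, hx, by simpa using hmA, ?_⟩
        convert hz using 1
        omega
      · rintro rfl
        convert hx using 1
        omega
    · have hxz : x ≠ z := by
        rintro rfl
        exact he ⟨x, rfl⟩
      rw [if_neg he, if_neg hxz, sum_eq_zero fun y _ ↦ if_neg fun h ↦ he ⟨y, by omega⟩]
      simp
  have hTle : T ≤ #A - α * (#A ^ 2 / 2) := by
    rw [hTval]
    simp_rw [sum_sub_distrib, ← mul_sum]
    have h1 : ∑ x ∈ A, ∑ z ∈ A, (if x = z then (1 : ℝ) else 0) = #A := by simp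
    rw [h1]
    gcongr
    exact sum_even_add_ge A
  have hTnorm : (M : ℝ) * |T| < α ^ 2 / 4 * N * (M * #A) := by
    have hsum := sum_fourierChar_threeAP M hM A (Ico (0 : ℤ) N) (balanced N A α)
    have hpars := sum_norm_sq_fourierChar hM (show N ≤ M by omega) hA
    calc (M : ℝ) * |T| = ‖(M : ℂ) * (T : ℂ)‖ := by simp
      _ ≤ ∑ r ∈ range M, ‖∑ x ∈ A, (𝐞 ((r : ℝ) * ((x : ℝ) / M)) : ℂ)‖ ^ 2 *
          ‖∑ y ∈ Ico (0 : ℤ) N, (balanced N A α y : ℂ) * 𝐞 ((y : ℝ) * (-2 * r / M))‖ := by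
        rw [← hsum]
        refine (norm_sum_le _ _).trans_eq (sum_congr rfl fun r _ ↦ ?_)
        rw [norm_mul, norm_pow]
      _ < ∑ r ∈ range M, ‖∑ x ∈ A, (𝐞 ((r : ℝ) * ((x : ℝ) / M)) : ℂ)‖ ^ 2 *
          (α ^ 2 / 4 * N) := by
        refine sum_lt_sum (fun r _ ↦ ?_) ⟨0, by simpa using hM, ?_⟩
        · gcongr
          exact (hsmall _).le
        · refine mul_lt_mul_of_pos_left (hsmall _) ?_
          simp only [Nat.cast_zero, zero_mul, AddChar.map_zero_eq_one, Circle.coe_one, sum_const,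
            nsmul_eq_mul, mul_one, Complex.norm_natCast]
          positivity
      _ = α ^ 2 / 4 * N * (M * #A) := by rw [← sum_mul, hpars, mul_comm]
  have h2 : |T| < α ^ 2 / 4 * N * #A := by
    refine lt_of_mul_lt_mul_left (hTnorm.trans_eq ?_) hM0.le
    ring
  have h3 := (abs_lt.1 h2).1
  have h4 : (#A : ℝ) * (α ^ 2 * N / 4) < #A * 1 := by
    have : α * ((#A : ℝ) ^ 2 / 2) = #A * (α ^ 2 * N / 2) := by
      rw [sq, hcard]; ring
    nlinarith
  have := lt_of_mul_lt_mul_left h4 hA0.le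
  linarith

/-- A large Fourier coefficient of a bounded mean-zero function gives a progression of step `q`
and length `L` on which the function has large sum. -/
lemma exists_sum_ge_of_large_fourier {N L q : ℕ} {f : ℤ → ℝ} {η θ : ℝ} (hN : 0 < N)
    (hL : 0 < L) (hη : 0 < η) (hsupp : ∀ x, x ∉ Ico (0 : ℤ) N → f x = 0)
    (hbound : ∀ x, f x ≤ 1) (hmean : ∑ x ∈ Ico (0 : ℤ) N, f x = 0)
    (hlarge : η * N ≤ ‖∑ x ∈ Ico (0 : ℤ) N, (f x : ℂ) * 𝐞 ((x : ℝ) * θ)‖)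
    (hLq : 16 * ((L : ℝ) * q) ≤ η * N) (hLqN : L * q ≤ N)
    (hq : ∀ j < L, ‖(𝐞 (-(j * q * θ)) : ℂ) - 1‖ ≤ 1 / 2) :
    ∃ a ∈ Ico (0 : ℤ) (N - L * q), η / 16 * L ≤ ∑ j ∈ range L, f (a + j * q) := by
  by_contra! hlt
  set K : ℤ := L * q with hK
  have hK0 : 0 ≤ K := by positivity
  have hKN : K ≤ N := by rw [hK]; exact_mod_cast hLqN
  set S : ℤ → ℝ := fun a ↦ ∑ j ∈ range L, f (a + j * q) with hS
  have hjK (j : ℕ) (hj : j ∈ range L) : (j : ℤ) * q ≤ K := by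
    have := (mem_range.1 hj).le
    rw [hK]; gcongr
  have hSsum : ∑ a ∈ Ico (-K) N, S a = 0 := by
    rw [sum_comm]
    refine sum_eq_zero fun j hj ↦ ?_
    rw [sum_Ico_add_of_support f hsupp (by positivity) (hjK j hj), hmean]
  have hSfourier : ∑ a ∈ Ico (-K) N, (S a : ℂ) * 𝐞 ((a : ℝ) * θ) =
      (∑ x ∈ Ico (0 : ℤ) N, (f x : ℂ) * 𝐞 ((x : ℝ) * θ)) *
        ∑ j ∈ range L, (𝐞 (-(j * q * θ)) : ℂ) := by
    simp only [hS]
    push_cast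
    simp_rw [sum_mul]
    rw [sum_comm, ← sum_mul, mul_sum]
    refine sum_congr rfl fun j hj ↦ ?_
    rw [← sum_Ico_add_of_support (fun x : ℤ ↦ (f x : ℂ) * (𝐞 ((x : ℝ) * θ) : ℂ))
      (fun x hx ↦ by simp [hsupp x hx]) (by positivity) (hjK j hj), sum_mul]
    refine sum_congr rfl fun a _ ↦ ?_
    rw [mul_assoc, ← fourierChar_add_coe]
    congr 3
    push_cast
    ring
  have hker : (L : ℝ) / 2 ≤ ‖∑ j ∈ range L, (𝐞 (-(j * q * θ)) : ℂ)‖ := by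
    have h1 : ‖∑ j ∈ range L, ((𝐞 (-(j * q * θ)) : ℂ) - 1)‖ ≤ L * (1 / 2) := by
      refine (norm_sum_le_of_le _ fun j hj ↦ hq j (mem_range.1 hj)).trans_eq ?_
      simp
    rw [sum_sub_distrib, norm_sub_rev] at h1
    have h2 := norm_sub_norm_le (∑ j ∈ range L, (1 : ℂ)) (∑ j ∈ range L, (𝐞 (-(j * q * θ)) : ℂ))
    have h3 : ‖∑ j ∈ range L, (1 : ℂ)‖ = L := by simp
    linarith
  have habs : η * N * (L / 2) ≤ ∑ a ∈ Ico (-K) N, |S a| := by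
    calc η * N * (L / 2) ≤ _ := mul_le_mul hlarge hker (by positivity) (norm_nonneg _)
      _ = ‖∑ a ∈ Ico (-K) N, (S a : ℂ) * 𝐞 ((a : ℝ) * θ)‖ := by rw [hSfourier, norm_mul]
      _ ≤ ∑ a ∈ Ico (-K) N, |S a| := by
        refine (norm_sum_le _ _).trans_eq (sum_congr rfl fun a _ ↦ ?_)
        rw [norm_mul, Circle.norm_coe, mul_one, Complex.norm_real, Real.norm_eq_abs]
  have hSL (a : ℤ) : S a ≤ L := by
    refine (sum_le_sum fun j _ ↦ hbound _).trans_eq ?_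
    simp
  have hpos : ∑ a ∈ Ico (-K) N, (|S a| + S a) =
      ∑ a ∈ Ico (-K) 0, (|S a| + S a) + ∑ a ∈ Ico 0 (N - K), (|S a| + S a) +
        ∑ a ∈ Ico (N - K) N, (|S a| + S a) := by
    rw [← Finset.Ico_union_Ico_eq_Ico (show -K ≤ N - K by omega) (show (N : ℤ) - K ≤ N by omega),
      sum_union (Finset.Ico_disjoint_Ico_consecutive _ _ _),
      ← Finset.Ico_union_Ico_eq_Ico (show -K ≤ 0 by omega) (show 0 ≤ (N : ℤ) - K by omega),
      sum_union (Finset.Ico_disjoint_Ico_consecutive _ _ _)]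
  have hle {a : ℤ} {B : ℝ} (hB : 0 ≤ B) (h : S a ≤ B) : |S a| + S a ≤ 2 * B := by
    rcases abs_cases (S a) with h' | h' <;> linarith
  have hKR : ((K : ℤ) : ℝ) = L * q := by rw [hK]; push_cast; ring
  have hcast (k : ℤ) (hk : 0 ≤ k) : ((k.toNat : ℕ) : ℝ) = k := by
    exact_mod_cast Int.toNat_of_nonneg hk
  have hb1 : ∑ a ∈ Ico (-K) 0, (|S a| + S a) ≤ K * (2 * L) := by
    refine (sum_le_card_nsmul _ _ _ fun a _ ↦ hle (by positivity) (hSL a)).trans_eq ?_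
    rw [nsmul_eq_mul, Int.card_Ico, hcast _ (by omega)]
    push_cast; ring
  have hb2 : ∑ a ∈ Ico (N - K) (N : ℤ), (|S a| + S a) ≤ K * (2 * L) := by
    refine (sum_le_card_nsmul _ _ _ fun a _ ↦ hle (by positivity) (hSL a)).trans_eq ?_
    rw [nsmul_eq_mul, Int.card_Ico, hcast _ (by omega)]
    push_cast; ring
  have hLR : (0 : ℝ) < L := by exact_mod_cast hL
  have hNR : (0 : ℝ) < N := by exact_mod_cast hN
  have hmid : ∑ a ∈ Ico (0 : ℤ) (N - K), (|S a| + S a) ≤ N * (2 * (η / 16 * L)) := by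
    refine (sum_le_card_nsmul _ _ _ fun a ha ↦ hle (by positivity) (hlt a ha).le).trans ?_
    rw [nsmul_eq_mul, Int.card_Ico, hcast _ (by omega)]
    gcongr
    push_cast
    linarith [show (0 : ℝ) ≤ K by exact_mod_cast hK0]
  rw [sum_add_distrib, hSsum] at hpos
  rw [hKR] at hb1 hb2
  have hLmul := mul_le_mul_of_nonneg_right hLq hLR.le
  have : 0 < η * N * L := by positivity
  linarith

lemma norm_fourierChar_sub_one_le (t : ℝ) (m : ℤ) :
    ‖(𝐞 t : ℂ) - 1‖ ≤ 2 * Real.pi * |t - m| := by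
  have hm : (𝐞 (m : ℝ) : ℂ) = 1 := by
    rw [Real.fourierChar_apply, Complex.exp_eq_one_iff]
    exact ⟨m, by push_cast; ring⟩
  have ht : (𝐞 t : ℂ) = Complex.exp (Complex.I * (2 * Real.pi * (t - m) : ℝ)) := by
    rw [← sub_add_cancel t m, fourierChar_add_coe, hm, mul_one, Real.fourierChar_apply,
      mul_comm Complex.I]
    simp
  rw [ht]
  refine (Real.norm_exp_I_mul_ofReal_sub_one_le).trans_eq ?_
  rw [Real.norm_eq_abs, abs_mul, abs_of_pos Real.two_pi_pos]

lemma sum_balanced {N : ℕ} {A : Finset ℤ} (hA : A ⊆ Ico (0 : ℤ) N) {α : ℝ}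
    (hcard : (#A : ℝ) = α * N) : ∑ x ∈ Ico (0 : ℤ) N, balanced N A α x = 0 := by
  simp only [balanced, sum_sub_distrib, ← mul_sum, sum_ite_mem, inter_self,
    inter_eq_right.2 hA, sum_const, Int.card_Ico, nsmul_eq_mul, mul_one, hcard]
  simp

lemma IsAP.image_range (a s : ℤ) (hs : s ≠ 0) {k : ℕ} (hk : 1 ≤ k) :
    IsAP ((range k).image fun i : ℕ ↦ a + (i : ℤ) * s) :=
  ⟨a, s, hs, k, hk, rfl⟩

/-- Density increment: there are absolute constants `c, C > 0` such that if
`A ⊆ {0,…,N−1}` is 3AP-free of density `α > 0` and `N ≥ C·α⁻³²`, then there is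
an arithmetic progression `P ⊆ {0,…,N−1}` with `|P| ≥ c·α¹⁶·N^(1/2)` and
`|A ∩ P| ≥ (α + c·α¹¹)·|P|`. -/
theorem density_increment :
    ∃ c C : ℝ, 0 < c ∧ 0 < C ∧
      ∀ (N : ℕ) (A : Finset ℤ), A ⊆ Finset.Ico (0 : ℤ) (N : ℤ) →
      ∀ α : ℝ, 0 < α → (A.card : ℝ) = α * N →
        (¬ ∃ x r : ℤ, r ≠ 0 ∧ x ∈ A ∧ x + r ∈ A ∧ x + 2 * r ∈ A) →
        C * α⁻¹ ^ 32 ≤ (N : ℝ) →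
        ∃ P : Finset ℤ, IsAP P ∧ P ⊆ Finset.Ico (0 : ℤ) (N : ℤ) ∧
          c * α ^ 16 * Real.sqrt N ≤ (P.card : ℝ) ∧
          (α + c * α ^ 11) * (P.card : ℝ) ≤ ((A ∩ P).card : ℝ) := by
  refine ⟨1 / 256, 2 ^ 20, by norm_num, by norm_num, fun N A hA α hα hcard hfree hNα ↦ ?_⟩
  have hNR : (0 : ℝ) < N := lt_of_lt_of_le (by positivity) hNα
  have hN : 0 < N := by exact_mod_cast hNR
  have hα1 : α ≤ 1 := by
    have h := card_le_card hA
    rw [Int.card_Ico, sub_zero, Int.toNat_natCast] at h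
    have h' : α * N ≤ 1 * N := by
      rw [← hcard, one_mul]; exact_mod_cast h
    exact le_of_mul_le_mul_right h' hNR
  have hα4N : 2 ^ 20 ≤ α ^ 4 * N := by
    calc (2 : ℝ) ^ 20 = 2 ^ 20 * (α ^ 32 * α⁻¹ ^ 32) := by
          rw [← mul_pow, mul_inv_cancel₀ hα.ne', one_pow, mul_one]
      _ ≤ 2 ^ 20 * (α ^ 4 * α⁻¹ ^ 32) := by
          gcongr 2 ^ 20 * (?_ * _)
          exact pow_le_pow_of_le_one hα.le hα1 (by norm_num)
      _ = α ^ 4 * (2 ^ 20 * α⁻¹ ^ 32) := by ring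
      _ ≤ α ^ 4 * N := by gcongr
  have hsqrt : 2 ^ 10 ≤ α ^ 2 * √N := by
    refine le_of_sq_le_sq ?_ (by positivity)
    rw [mul_pow, Real.sq_sqrt hNR.le]
    linarith
  have hα2 : α ^ 2 ≤ 1 := pow_le_one₀ hα.le hα1
  obtain ⟨θ, hθ⟩ := exists_large_fourier hA hα hcard hfree (by nlinarith)
  set Q : ℕ := ⌊√N⌋₊ with hQ
  have hQle : (Q : ℝ) ≤ √N := Nat.floor_le (by positivity)
  have hsqrt1 : 2 ^ 10 ≤ √N := by nlinarith [Real.sqrt_nonneg N]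
  have hQge : √N / 2 ≤ Q := by linarith [Nat.lt_floor_add_one √N]
  have hQ0 : 0 < Q := Nat.floor_pos.2 (by linarith)
  obtain ⟨q, hq0, hqQ, hqθ⟩ := Real.exists_nat_abs_mul_sub_round_le θ hQ0
  have hqR : (q : ℝ) ≤ Q := by exact_mod_cast hqQ
  set L : ℕ := ⌊α ^ 2 / 64 * Q⌋₊ with hL
  have hLle : (L : ℝ) ≤ α ^ 2 / 64 * Q := Nat.floor_le (by positivity)
  have hα2Q : α ^ 2 * (√N / 2) ≤ α ^ 2 * Q := by gcongr
  have hLge : α ^ 2 / 256 * √N ≤ L := by linarith [Nat.lt_floor_add_one (α ^ 2 / 64 * Q)]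
  have hL0 : 0 < L := Nat.floor_pos.2 (by linarith)
  have hQsq : (Q : ℝ) * Q ≤ N := by
    calc (Q : ℝ) * Q ≤ √N * √N := by gcongr
      _ = N := Real.mul_self_sqrt hNR.le
  have hLq : (L : ℝ) * q ≤ α ^ 2 / 64 * N := by
    calc (L : ℝ) * q ≤ α ^ 2 / 64 * Q * Q := by gcongr
      _ = α ^ 2 / 64 * (Q * Q) := by ring
      _ ≤ α ^ 2 / 64 * N := by gcongr
  have hsupp (x : ℤ) (hx : x ∉ Ico (0 : ℤ) N) : balanced N A α x = 0 := by
    simp only [balanced, if_neg hx, if_neg (fun h ↦ hx (hA h))]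
    simp
  obtain ⟨a, ha, hsum⟩ := exists_sum_ge_of_large_fourier (L := L) (q := q)
    (f := balanced N A α) (η := α ^ 2 / 4) (θ := θ) hN hL0 (by positivity) hsupp
    (fun x ↦ by unfold balanced; split_ifs <;> linarith) (sum_balanced hA hcard) hθ (by linarith)
    (by
      have : (L : ℝ) * q ≤ N := by nlinarith
      exact_mod_cast this)
    fun j hj ↦ by
      refine (norm_fourierChar_sub_one_le _ (-(j * round (q * θ)))).trans ?_
      have h1 : |-((j : ℝ) * q * θ) - ((-(j * round (q * θ)) : ℤ) : ℝ)| =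
          j * |q * θ - round (q * θ)| := by
        rw [← abs_of_nonneg (Nat.cast_nonneg (α := ℝ) j), ← abs_mul, ← abs_neg]
        congr 1
        rw [abs_of_nonneg (Nat.cast_nonneg (α := ℝ) j)]
        push_cast
        ring
      have h2 : (j : ℝ) * |q * θ - round (q * θ)| ≤ 1 / 64 := by
        have hjL : (j : ℝ) ≤ L := by exact_mod_cast hj.le
        calc (j : ℝ) * |q * θ - round (q * θ)| ≤ α ^ 2 / 64 * Q * (1 / (Q + 1)) := by
              gcongr
              exact hjL.trans hLle
          _ = α ^ 2 / 64 * (Q / (Q + 1)) := by ring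
          _ ≤ 1 / 64 * 1 := by
              gcongr
              exact div_le_one_of_le₀ (by linarith) (by positivity)
          _ = 1 / 64 := by norm_num
      rw [h1]
      nlinarith [Real.pi_lt_four, Real.pi_pos]
  have hqZ : (q : ℤ) ≠ 0 := by exact_mod_cast hq0.ne'
  have hinj : Function.Injective fun i : ℕ ↦ a + (i : ℤ) * q := fun i j hij ↦ by
    simpa [hq0.ne'] using hij
  have hcardP : #((range L).image fun i : ℕ ↦ a + (i : ℤ) * q) = L := by
    rw [card_image_of_injective _ hinj, card_range]
  have hsub : ((range L).image fun i : ℕ ↦ a + (i : ℤ) * q) ⊆ Ico (0 : ℤ) N := by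
    intro x hx
    obtain ⟨i, hi, rfl⟩ := mem_image.1 hx
    rw [mem_Ico] at *
    have : (i : ℤ) * q ≤ L * q := by
      have := (mem_range.1 hi).le
      gcongr
    have : (0 : ℤ) ≤ i * q := by positivity
    omega
  refine ⟨_, IsAP.image_range a q hqZ hL0, hsub, ?_, ?_⟩
  · rw [hcardP]
    refine le_trans ?_ hLge
    have : α ^ 16 ≤ α ^ 2 := pow_le_pow_of_le_one hα.le hα1 (by norm_num)
    calc 1 / 256 * α ^ 16 * √N ≤ 1 / 256 * α ^ 2 * √N := by gcongr
      _ = α ^ 2 / 256 * √N := by ring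
  · have hsum' : ∑ j ∈ range L, balanced N A α (a + j * q) =
        #(A ∩ (range L).image fun i : ℕ ↦ a + (i : ℤ) * q) - α * L := by
      rw [← sum_image (f := balanced N A α) (g := fun i : ℕ ↦ a + (i : ℤ) * q)
        fun i _ j _ h ↦ hinj h]
      simp only [balanced, sum_sub_distrib, ← mul_sum, sum_ite_mem, inter_eq_left.2 hsub,
        sum_const, nsmul_eq_mul, mul_one, hcardP, inter_comm A]
    rw [hsum'] at hsum
    rw [hcardP]
    have h11 : α ^ 11 * L ≤ α ^ 2 * L := by
      gcongr ?_ * _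
      exact pow_le_pow_of_le_one hα.le hα1 (by norm_num)
    have : 0 ≤ α ^ 2 * L := by positivity
    linarith
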